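/- arXiv:1503.04482 — 2 statements merged into one kernel-verified Lean document; each statement's English description precedes it below -/
import Mathlib

section
/- For each of the six matrices M ∈ { (1/(3√3))·[[0,5,0,2,0],[5,0,4,0,2],[0,4,0,4,0],[2,0,4,0,5],[0,2,0,5,0]], (1/√6)·[[0,0,0,0,3√2],[0,0,1,0,0],[0,1,0,1,0],[0,0,1,0,0],[3√2,0,0,0,0]], (1/√6)·[[0,0,3,0,0],[0,0,0,√2,0],[3,0,0,0,3],[0,√2,0,0,0],[0,0,3,0,0]], (1/√3)·[[0,1,0,2,0],[1,0,0,0,2],[0,0,0,0,0],[2,0,0,0,1],[0,2,0,1,0]], (1/√3)·[[0,√3,0,0,0],[√3,0,0,2,0],[0,0,0,0,0],[0,2,0,0,√3],[0,0,0,√3,0]], (1/√3)·[[0,0,0,0,3],[0,0,0,1,0],[0,0,0,0,0],[0,1,0,0,0],[3,0,0,0,0]] }, the family L(t) := cos(t)·L0 + sin(t)·M is isospectral: for every t ∈ ℝ the characteristic polynomial of L(t) equals x·(x² − 3)·(x² − 1/3), so L(t) has eigenvalues exactly −√3, −1/√3, 0, 1/√3, √3, each with multiplicity 1. -/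
open Matrix Kronecker

noncomputable section

/-- `L0 = diag(√3, 1/√3, 0, -1/√3, -√3)`. -/
def L0d : Matrix (Fin 5) (Fin 5) ℝ :=
  Matrix.diagonal ![Real.sqrt 3, 1 / Real.sqrt 3, 0, -(1 / Real.sqrt 3), -Real.sqrt 3]

/-- The family `L(t) = cos(t)·L0 + sin(t)·L1` is isospectral: for every `t` the matrix
`L(t)` has eigenvalues exactly `-√3, -1/√3, 0, 1/√3, √3`, each with multiplicity one,
i.e. its characteristic polynomial is `X·(X² - 3)·(X² - 1/3)`. -/
def Isospectral (L1 : Matrix (Fin 5) (Fin 5) ℝ) : Prop :=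
  ∀ t : ℝ, (Real.cos t • L0d + Real.sin t • L1).charpoly =
    Polynomial.X * (Polynomial.X ^ 2 - Polynomial.C 3) *
      (Polynomial.X ^ 2 - Polynomial.C (1 / 3 : ℝ))

/-- `L₊ = ½(L0 - i·L1)`, viewed as a complex matrix. -/
def LplusF (L1 : Matrix (Fin 5) (Fin 5) ℝ) : Matrix (Fin 5) (Fin 5) ℂ :=
  (1 / 2 : ℂ) • (L0d.map Complex.ofReal - Complex.I • L1.map Complex.ofReal)

/-- `E`: the real subspace of `ℝ⁵` spanned by the kernels `ker L(t)`, `t ∈ ℝ`. -/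
def Espan (L1 : Matrix (Fin 5) (Fin 5) ℝ) : Submodule ℝ (Fin 5 → ℝ) :=
  ⨆ t : ℝ, LinearMap.ker (Real.cos t • L0d + Real.sin t • L1).mulVecLin

/-- The first normal form of `L1`. -/
def M₁ : Matrix (Fin 5) (Fin 5) ℝ :=
  (1 / (3 * Real.sqrt 3)) •
    !![0, 5, 0, 2, 0; 5, 0, 4, 0, 2; 0, 4, 0, 4, 0; 2, 0, 4, 0, 5; 0, 2, 0, 5, 0]

/-- The second normal form of `L1`. -/
def M₂ : Matrix (Fin 5) (Fin 5) ℝ :=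
  (1 / Real.sqrt 6) •
    !![0, 0, 0, 0, 3 * Real.sqrt 2; 0, 0, 1, 0, 0; 0, 1, 0, 1, 0; 0, 0, 1, 0, 0;
       3 * Real.sqrt 2, 0, 0, 0, 0]

/-- The third normal form of `L1`. -/
def M₃ : Matrix (Fin 5) (Fin 5) ℝ :=
  (1 / Real.sqrt 6) •
    !![0, 0, 3, 0, 0; 0, 0, 0, Real.sqrt 2, 0; 3, 0, 0, 0, 3; 0, Real.sqrt 2, 0, 0, 0;
       0, 0, 3, 0, 0]

/-- The fourth normal form of `L1`. -/
def M₄ : Matrix (Fin 5) (Fin 5) ℝ :=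
  (1 / Real.sqrt 3) •
    !![0, 1, 0, 2, 0; 1, 0, 0, 0, 2; 0, 0, 0, 0, 0; 2, 0, 0, 0, 1; 0, 2, 0, 1, 0]

/-- The fifth normal form of `L1`. -/
def M₅ : Matrix (Fin 5) (Fin 5) ℝ :=
  (1 / Real.sqrt 3) •
    !![0, Real.sqrt 3, 0, 0, 0; Real.sqrt 3, 0, 0, 2, 0; 0, 0, 0, 0, 0;
       0, 2, 0, 0, Real.sqrt 3; 0, 0, 0, Real.sqrt 3, 0]

/-- The sixth normal form of `L1`. -/
def M₆ : Matrix (Fin 5) (Fin 5) ℝ :=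
  (1 / Real.sqrt 3) •
    !![0, 0, 0, 0, 3; 0, 0, 0, 1, 0; 0, 0, 0, 0, 0; 0, 1, 0, 0, 0; 3, 0, 0, 0, 0]

/-- If the characteristic polynomial of `C • diag(3, 1, 0, -1, -3) + S • B` depends on `(C, S)` only
through `C ^ 2 + S ^ 2`, then `B / √3` generates an isospectral family. -/
lemma isospectral_of_det_eq {B : Matrix (Fin 5) (Fin 5) ℝ}
    (hB : ∀ x C S : ℝ,
      (Matrix.scalar (Fin 5) x - (C • Matrix.diagonal ![3, 1, 0, -1, -3] + S • B)).det =
        x * (x ^ 2 - 9 * (C ^ 2 + S ^ 2)) * (x ^ 2 - (C ^ 2 + S ^ 2))) :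
    Isospectral ((1 / Real.sqrt 3) • B) := by
  intro t
  have h3 : Real.sqrt 3 * Real.sqrt 3 = 3 := Real.mul_self_sqrt (by norm_num)
  have hL : L0d = (1 / Real.sqrt 3) • Matrix.diagonal ![3, 1, 0, -1, -3] := by
    rw [L0d, ← Matrix.diagonal_smul]
    congr 1
    ext i
    fin_cases i <;> simp <;> field_simp <;> linarith
  have hsum : (Real.cos t * (1 / Real.sqrt 3)) ^ 2 + (Real.sin t * (1 / Real.sqrt 3)) ^ 2 =
      1 / 3 := by
    rw [mul_pow, mul_pow, ← add_mul, Real.cos_sq_add_sin_sq, div_pow,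
      Real.sq_sqrt (by norm_num)]
    norm_num
  refine Polynomial.funext fun x => ?_
  rw [Matrix.eval_charpoly, hL, smul_smul, smul_smul, hB, hsum]
  simp only [Polynomial.eval_mul, Polynomial.eval_sub, Polynomial.eval_pow, Polynomial.eval_X,
    Polynomial.eval_C]
  ring

lemma isospectral_M₁ : Isospectral M₁ := by
  have hM : M₁ = (1 / Real.sqrt 3) •
      ((1 / 3 : ℝ) • !![0, 5, 0, 2, 0; 5, 0, 4, 0, 2; 0, 4, 0, 4, 0; 2, 0, 4, 0, 5;
        0, 2, 0, 5, 0] : Matrix (Fin 5) (Fin 5) ℝ) := by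
    rw [M₁, smul_smul]
    congr 1
    ring
  rw [hM]
  refine isospectral_of_det_eq fun x C S => ?_
  simp [Matrix.det_succ_row_zero, Fin.sum_univ_succ, Matrix.diagonal_apply, Fin.succAbove]
  ring

lemma sqrt_six : Real.sqrt 6 = Real.sqrt 3 * Real.sqrt 2 := by
  rw [← Real.sqrt_mul (by norm_num)]
  norm_num

lemma isospectral_M₂ : Isospectral M₂ := by
  have hM : M₂ = (1 / Real.sqrt 3) •
      (!![0, 0, 0, 0, 3; 0, 0, 1 / Real.sqrt 2, 0, 0; 0, 1 / Real.sqrt 2, 0, 1 / Real.sqrt 2, 0;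
        0, 0, 1 / Real.sqrt 2, 0, 0; 3, 0, 0, 0, 0] : Matrix (Fin 5) (Fin 5) ℝ) := by
    ext i j
    fin_cases i <;> fin_cases j <;> simp [M₂, sqrt_six] <;> field_simp
  rw [hM]
  refine isospectral_of_det_eq fun x C S => ?_
  have hsq : Real.sqrt 2 ^ 2 = 2 := Real.sq_sqrt (by norm_num)
  simp [Matrix.det_succ_row_zero, Fin.sum_univ_succ, Matrix.diagonal_apply, Fin.succAbove]
  field_simp
  simp only [hsq]
  ring

lemma isospectral_M₃ : Isospectral M₃ := by
  have hM : M₃ = (1 / Real.sqrt 3) •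
      (!![0, 0, 3 / Real.sqrt 2, 0, 0; 0, 0, 0, 1, 0; 3 / Real.sqrt 2, 0, 0, 0, 3 / Real.sqrt 2;
        0, 1, 0, 0, 0; 0, 0, 3 / Real.sqrt 2, 0, 0] : Matrix (Fin 5) (Fin 5) ℝ) := by
    ext i j
    fin_cases i <;> fin_cases j <;> simp [M₃, sqrt_six] <;> field_simp
  rw [hM]
  refine isospectral_of_det_eq fun x C S => ?_
  have hsq : Real.sqrt 2 ^ 2 = 2 := Real.sq_sqrt (by norm_num)
  simp [Matrix.det_succ_row_zero, Fin.sum_univ_succ, Matrix.diagonal_apply, Fin.succAbove]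
  field_simp
  simp only [hsq]
  ring

lemma isospectral_M₄ : Isospectral M₄ := by
  refine isospectral_of_det_eq fun x C S => ?_
  simp [Matrix.det_succ_row_zero, Fin.sum_univ_succ, Matrix.diagonal_apply, Fin.succAbove]
  ring

lemma isospectral_M₅ : Isospectral M₅ := by
  refine isospectral_of_det_eq fun x C S => ?_
  have hsq : Real.sqrt 3 ^ 2 = 3 := Real.sq_sqrt (by norm_num)
  have hpow : Real.sqrt 3 ^ 4 = 9 := by
    rw [show 4 = 2 * 2 from rfl, pow_mul, hsq]
    norm_num
  simp [Matrix.det_succ_row_zero, Fin.sum_univ_succ, Matrix.diagonal_apply, Fin.succAbove]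
  ring_nf
  simp only [hsq, hpow]
  ring

lemma isospectral_M₆ : Isospectral M₆ := by
  refine isospectral_of_det_eq fun x C S => ?_
  simp [Matrix.det_succ_row_zero, Fin.sum_univ_succ, Matrix.diagonal_apply, Fin.succAbove]
  ring

/-- each of the six matrices `M₁, …, M₆` gives rise to an isospectral
family `L(t) = cos(t)·L0 + sin(t)·M`: for every `t` the characteristic polynomial of
`L(t)` equals `X·(X² - 3)·(X² - 1/3)`, so `L(t)` has eigenvalues exactly
`-√3, -1/√3, 0, 1/√3, √3`, each with multiplicity one. -/
theorem statement17 :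
    ∀ M ∈ ({M₁, M₂, M₃, M₄, M₅, M₆} : Set (Matrix (Fin 5) (Fin 5) ℝ)),
      ∀ t : ℝ, (Real.cos t • L0d + Real.sin t • M).charpoly =
        Polynomial.X * (Polynomial.X ^ 2 - Polynomial.C 3) *
          (Polynomial.X ^ 2 - Polynomial.C (1 / 3 : ℝ)) := by
  rintro M (rfl | rfl | rfl | rfl | rfl | rfl)
  exacts [isospectral_M₁, isospectral_M₂, isospectral_M₃, isospectral_M₄, isospectral_M₅,
    isospectral_M₆]

end
end

section
/- Let L1 := (1/(3√3))·[[0,5,0,2,0],[5,0,4,0,2],[0,4,0,4,0],[2,0,4,0,5],[0,2,0,5,0]] and L(t) := cos(t)·L0 + sin(t)·L1. Then for every t ∈ ℝ the vector e₃(t) := ((4/9)·sin²t, −(2/3)·sin(2t), (1/9)·(1 + 8·cos(2t)), (2/3)·sin(2t), (4/9)·sin²t) is a unit vector in the kernel of L(t), and the real subspace E spanned by the kernels ker L(t) over all t ∈ ℝ equals the span of the three vectors (0,0,1,0,0), (1,0,0,0,1), (0,−1,0,1,0); in particular dim E = 3 and for these t the kernel of L(t) is not constant. -/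
open Matrix Kronecker

noncomputable section

/-- The curve of kernel vectors `e₃(t)`. -/
def e3vec (t : ℝ) : Fin 5 → ℝ :=
  ![4 / 9 * Real.sin t ^ 2, -(2 / 3 * Real.sin (2 * t)),
    1 / 9 * (1 + 8 * Real.cos (2 * t)), 2 / 3 * Real.sin (2 * t), 4 / 9 * Real.sin t ^ 2]

/-- `3√3 · L(t)` applied to a vector, in coordinates. -/
theorem mulVec_pencil_eq_smul (t : ℝ) (v : Fin 5 → ℝ) :
    (Real.cos t • L0d + Real.sin t • M₁).mulVec v = (1 / (3 * Real.sqrt 3)) •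
      ![9 * Real.cos t * v 0 + Real.sin t * (5 * v 1 + 2 * v 3),
        3 * Real.cos t * v 1 + Real.sin t * (5 * v 0 + 4 * v 2 + 2 * v 4),
        Real.sin t * (4 * v 1 + 4 * v 3),
        -3 * Real.cos t * v 3 + Real.sin t * (2 * v 0 + 4 * v 2 + 5 * v 4),
        -9 * Real.cos t * v 4 + Real.sin t * (2 * v 1 + 5 * v 3)] := by
  have h3 : Real.sqrt 3 ^ 2 = 3 := Real.sq_sqrt (by norm_num)
  have h0 : Real.sqrt 3 ≠ 0 := by positivity
  ext i
  fin_cases i <;>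
    simp [L0d, M₁, Matrix.mulVec, dotProduct, Fin.sum_univ_five, Matrix.diagonal] <;>
    field_simp <;> (try rw [h3]) <;> ring

theorem mem_ker_pencil_iff (t : ℝ) (v : Fin 5 → ℝ) :
    v ∈ LinearMap.ker (Real.cos t • L0d + Real.sin t • M₁).mulVecLin ↔
      9 * Real.cos t * v 0 + Real.sin t * (5 * v 1 + 2 * v 3) = 0 ∧
      3 * Real.cos t * v 1 + Real.sin t * (5 * v 0 + 4 * v 2 + 2 * v 4) = 0 ∧
      Real.sin t * (4 * v 1 + 4 * v 3) = 0 ∧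
      -3 * Real.cos t * v 3 + Real.sin t * (2 * v 0 + 4 * v 2 + 5 * v 4) = 0 ∧
      -9 * Real.cos t * v 4 + Real.sin t * (2 * v 1 + 5 * v 3) = 0 := by
  have h0 : (1 / (3 * Real.sqrt 3)) ≠ 0 := by positivity
  rw [LinearMap.mem_ker, Matrix.mulVecLin_apply, mulVec_pencil_eq_smul,
    smul_eq_zero_iff_right h0, funext_iff, Fin.forall_fin_succ]
  simp [Fin.forall_fin_succ]

theorem e3vec_dotProduct_self (t : ℝ) : e3vec t ⬝ᵥ e3vec t = 1 := by
  simp only [e3vec, dotProduct, Fin.sum_univ_five, Real.sin_two_mul, Real.cos_two_mul]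
  simp
  have h := Real.sin_sq_add_cos_sq t
  have hs : Real.sin t ^ 2 = 1 - Real.cos t ^ 2 := by linarith
  ring_nf
  rw [show Real.sin t ^ 4 = (Real.sin t ^ 2) ^ 2 by ring, hs]
  ring

theorem e3vec_mem_ker (t : ℝ) :
    e3vec t ∈ LinearMap.ker (Real.cos t • L0d + Real.sin t • M₁).mulVecLin := by
  have h := Real.sin_sq_add_cos_sq t
  rw [mem_ker_pencil_iff]
  simp only [e3vec, Real.sin_two_mul, Real.cos_two_mul]
  simp
  refine ⟨?_, ?_, ?_, ?_⟩
  · ring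
  · linear_combination (28 / 9 * Real.sin t) * h
  · linear_combination (28 / 9 * Real.sin t) * h
  · ring

theorem e3vec_mem_Espan (t : ℝ) : e3vec t ∈ Espan M₁ :=
  Submodule.mem_iSup_of_mem t (e3vec_mem_ker t)

theorem symm_of_mem_ker {t : ℝ} {v : Fin 5 → ℝ}
    (hv : v ∈ LinearMap.ker (Real.cos t • L0d + Real.sin t • M₁).mulVecLin) :
    v 4 = v 0 ∧ v 3 = -v 1 := by
  obtain ⟨h0, h1, h2, h3, h4⟩ := (mem_ker_pencil_iff t v).1 hv
  by_cases hs : Real.sin t = 0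
  · have hc : Real.cos t ≠ 0 := fun hc => by
      simpa [hs, hc] using Real.sin_sq_add_cos_sq t
    simp [hs, hc] at h0 h1 h3 h4
    simp [h0, h1, h3, h4]
  · have h13 : v 3 = -v 1 := by
      have := (mul_eq_zero.1 h2).resolve_left hs
      linarith
    have : Real.sin t * (v 0 - v 4) = 0 := by
      linear_combination (h1 - h3) / 3 - Real.cos t * h13
    exact ⟨by linarith [(mul_eq_zero.1 this).resolve_left hs], h13⟩

theorem Espan_M₁_eq_span : Espan M₁ = Submodule.span ℝ
    {![0, 0, 1, 0, 0], ![1, 0, 0, 0, 1], ![0, -1, 0, 1, 0]} := by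
  apply le_antisymm
  · refine iSup_le fun t v hv => ?_
    obtain ⟨h4, h3⟩ := symm_of_mem_ker hv
    rw [Submodule.mem_span_triple]
    refine ⟨v 2, v 0, -v 1, ?_⟩
    ext i
    fin_cases i <;> simp [h3, h4]
  · have two_mul_quarter : 2 * (Real.pi / 4) = Real.pi / 2 := by ring
    have two_mul_half : 2 * (Real.pi / 2) = Real.pi := by ring
    have sq_half_sqrt : (Real.sqrt 2 / 2) ^ 2 = 1 / 2 := by
      rw [div_pow, Real.sq_sqrt (by norm_num)]; norm_num
    have e0 := e3vec_mem_Espan 0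
    have e1 := e3vec_mem_Espan (Real.pi / 2)
    have e2 := e3vec_mem_Espan (Real.pi / 4)
    rw [Submodule.span_le]
    rintro v (rfl | rfl | rfl)
    · rw [SetLike.mem_coe]
      convert e0 using 1
      ext i
      fin_cases i <;> norm_num [e3vec]
    · rw [SetLike.mem_coe]
      convert (Espan M₁).add_mem ((Espan M₁).smul_mem (9 / 4) e1)
        ((Espan M₁).smul_mem (7 / 4) e0) using 1
      ext i
      fin_cases i <;> norm_num [e3vec, two_mul_half]
    · rw [SetLike.mem_coe]
      convert (Espan M₁).sub_mem ((Espan M₁).smul_mem (3 / 2) e2)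
        ((Espan M₁).smul_mem (3 / 4) ((Espan M₁).add_mem e0 e1)) using 1
      ext i
      fin_cases i <;> norm_num [e3vec, two_mul_half, two_mul_quarter, sq_half_sqrt]

theorem finrank_Espan_M₁ : Module.finrank ℝ (Espan M₁) = 3 := by
  have hli : LinearIndependent ℝ
      ![(![0, 0, 1, 0, 0] : Fin 5 → ℝ), ![1, 0, 0, 0, 1], ![0, -1, 0, 1, 0]] := by
    rw [Fintype.linearIndependent_iff]
    intro g hg
    have h2 := congrFun hg 2
    have h0 := congrFun hg 0
    have h3 := congrFun hg 3
    simp [Fin.sum_univ_three] at h0 h2 h3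
    intro i
    fin_cases i <;> simp [h0, h2, h3]
  have := finrank_span_eq_card hli
  rwa [Matrix.range_cons, Matrix.range_cons, Matrix.range_cons, Matrix.range_empty,
    Set.union_empty, Set.singleton_union, Set.singleton_union, ← Espan_M₁_eq_span] at this

/-- for `L1 = M₁` and `L(t) = cos(t)·L0 + sin(t)·L1`, the vector `e₃(t)` is
a unit vector in `ker L(t)` for every `t`; the span `E` of the kernels equals the span of
`(0,0,1,0,0)`, `(1,0,0,0,1)` and `(0,-1,0,1,0)`; in particular `dim E = 3` and the kernel
of `L(t)` is not constant in `t`. -/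
theorem statement18 :
    (∀ t : ℝ, e3vec t ⬝ᵥ e3vec t = 1 ∧
      (Real.cos t • L0d + Real.sin t • M₁).mulVec (e3vec t) = 0) ∧
    Espan M₁ = Submodule.span ℝ
      {![0, 0, 1, 0, 0], ![1, 0, 0, 0, 1], ![0, -1, 0, 1, 0]} ∧
    Module.finrank ℝ (Espan M₁) = 3 ∧
    ¬ (∀ t : ℝ, LinearMap.ker (Real.cos t • L0d + Real.sin t • M₁).mulVecLin =
        LinearMap.ker (Real.cos 0 • L0d + Real.sin 0 • M₁).mulVecLin) := by
  refine ⟨fun t => ⟨e3vec_dotProduct_self t, e3vec_mem_ker t⟩, Espan_M₁_eq_span,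
    finrank_Espan_M₁, fun h => ?_⟩
  have hmem := e3vec_mem_ker (Real.pi / 2)
  rw [h, mem_ker_pencil_iff] at hmem
  simpa [e3vec] using hmem.1

end
end
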